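/- Let n ≥ 4 be even and let P be an n-cycle sign pattern with 0-diagonal in standard labeling, with edge signs e i = P i (i+1) · P (i+1) i (indices mod n) for i ∈ ℤ/n. Suppose the cycle has a maximal signed path of odd length: there exist a ∈ ℤ/n and an odd k with 1 ≤ k < n such that e (a+t) = e a for all 0 ≤ t ≤ k−1, e (a−1) ≠ e a, and e (a+k) ≠ e a (all indices mod n). Then P does not require a unique inertia: there exist B₁, B₂ ∈ Q(P) with In(B₁) ≠ In(B₂). -/

import Mathlib

open Polynomial Matrix

def QClass {n : ℕ} (P : Matrix (Fin n) (Fin n) SignType) (B : Matrix (Fin n) (Fin n) ℝ) : Prop :=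
  ∀ i j, SignType.sign (B i j) = P i j

noncomputable def charRoots {n : ℕ} (B : Matrix (Fin n) (Fin n) ℝ) : Multiset ℂ :=
  ((B.charpoly).map (algebraMap ℝ ℂ)).roots

noncomputable def inertia {n : ℕ} (B : Matrix (Fin n) (Fin n) ℝ) : ℕ × ℕ × ℕ :=
  (((charRoots B).filter (fun z => 0 < z.re)).card,
   ((charRoots B).filter (fun z => z.re < 0)).card,
   ((charRoots B).filter (fun z => z.re = 0)).card)

theorem Matrix.charpoly_neg_of_bipartite {n : ℕ} {B : Matrix (Fin n) (Fin n) ℝ}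
    (hB : ∀ i j : Fin n, (i : ℕ) % 2 = j % 2 → B i j = 0) : (-B).charpoly = B.charpoly := by
  set D : Matrix (Fin n) (Fin n) ℝ := diagonal fun i => (-1) ^ (i : ℕ) with hD
  have h1 : -B = D * (B * D) := by
    ext i j
    rw [hD, diagonal_mul, mul_diagonal, neg_apply]
    by_cases h : (i : ℕ) % 2 = j % 2
    · simp [hB i j h]
    · rcases Nat.mod_two_eq_zero_or_one i with hi | hi <;>
        rcases Nat.mod_two_eq_zero_or_one j with hj | hj
      · omega
      · rw [(Nat.even_iff.2 hi).neg_one_pow, (Nat.odd_iff.2 hj).neg_one_pow]; ring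
      · rw [(Nat.odd_iff.2 hi).neg_one_pow, (Nat.even_iff.2 hj).neg_one_pow]; ring
      · omega
  have h2 : D * D = 1 := by
    rw [hD, diagonal_mul_diagonal, ← diagonal_one]
    congr 1
    ext i
    rw [← mul_pow]; norm_num
  rw [h1, charpoly_mul_comm, Matrix.mul_assoc, h2, Matrix.mul_one]

theorem Matrix.eval_charpoly_neg {n : ℕ} (B : Matrix (Fin n) (Fin n) ℝ) (x : ℝ) :
    (-B).charpoly.eval x = (-1) ^ n * B.charpoly.eval (-x) := by
  rw [eval_charpoly, eval_charpoly]
  have : scalar (Fin n) x - -B = -(scalar (Fin n) (-x) - B) := by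
    rw [map_neg]; abel
  rw [this, det_neg, Fintype.card_fin]

theorem Matrix.eval_charpoly_sq_of_bipartite {n : ℕ} {B : Matrix (Fin n) (Fin n) ℝ}
    (hB : ∀ i j : Fin n, (i : ℕ) % 2 = j % 2 → B i j = 0) {D : Fin n → ℝ}
    (hD : B * B = diagonal D) (x : ℝ) :
    B.charpoly.eval x ^ 2 = ∏ i, (x ^ 2 - D i) := by
  have h : B.charpoly.eval x ^ 2 = B.charpoly.eval x * (-B).charpoly.eval x := by
    rw [charpoly_neg_of_bipartite hB, sq]
  rw [h, eval_charpoly, eval_charpoly, ← det_mul, ← det_diagonal]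
  congr 1
  have hc : scalar (Fin n) x * B = B * scalar (Fin n) x := by
    ext i j
    simp [scalar_apply, diagonal_mul, mul_diagonal, mul_comm]
  have : (scalar (Fin n) x - B) * (scalar (Fin n) x - -B)
      = scalar (Fin n) x * scalar (Fin n) x - B * B := by
    rw [sub_neg_eq_add, sub_mul, mul_add, mul_add, hc]; abel
  rw [this, hD, scalar_apply, diagonal_mul_diagonal, diagonal_sub]
  congr 1
  ext i
  ring

/-- A function with the squared values of `x ^ m * ∏ (x ^ 2 - (v + 1) ^ 2)` changes sign at each
of the points `v + 1`. -/
theorem Polynomial.eval_mul_eval_neg_of_sq_eq {n m : ℕ} {M : Finset (Fin n)} {f : ℝ[X]}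
    (hf : ∀ x : ℝ, f.eval x ^ 2 = (x ^ m * ∏ v ∈ M, (x ^ 2 - ((v : ℕ) + 1 : ℝ) ^ 2)) ^ 2)
    {u : Fin n} (hu : u ∈ M) :
    f.eval ((u : ℕ) + 1 / 2 : ℝ) * f.eval ((u : ℕ) + 3 / 2 : ℝ) < 0 := by
  set g : ℝ[X] := X ^ m * ∏ v ∈ M, (X ^ 2 - C (((v : ℕ) + 1 : ℝ) ^ 2)) with hg
  have hge : ∀ x : ℝ, g.eval x = x ^ m * ∏ v ∈ M, (x ^ 2 - ((v : ℕ) + 1 : ℝ) ^ 2) := by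
    intro x
    simp [hg, eval_prod]
  have hsq : f ^ 2 = g ^ 2 := by
    apply Polynomial.funext
    intro x
    rw [eval_pow, eval_pow, hf, hge]
  have hfg : f.eval ((u : ℕ) + 1 / 2 : ℝ) * f.eval ((u : ℕ) + 3 / 2 : ℝ) =
      g.eval ((u : ℕ) + 1 / 2 : ℝ) * g.eval ((u : ℕ) + 3 / 2 : ℝ) := by
    rcases sq_eq_sq_iff_eq_or_eq_neg.1 hsq with h | h <;> simp [h]
  rw [hfg, hge, hge, mul_mul_mul_comm, ← Finset.prod_mul_distrib, ← Finset.mul_prod_erase _ _ hu]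
  have hu0 : (0 : ℝ) ≤ (u : ℕ) := Nat.cast_nonneg _
  refine mul_neg_of_pos_of_neg (by positivity) (mul_neg_of_neg_of_pos ?_ ?_)
  · apply mul_neg_of_neg_of_pos <;> nlinarith
  · refine Finset.prod_pos fun v hv => ?_
    have hv0 : (0 : ℝ) ≤ (v : ℕ) := Nat.cast_nonneg _
    have hne : (v : ℕ) ≠ u := fun h => (Finset.mem_erase.1 hv).1 (Fin.ext h)
    rcases lt_or_gt_of_ne hne with h | h
    · have h' : ((v : ℕ) : ℝ) + 1 ≤ (u : ℕ) := by exact_mod_cast h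
      apply mul_pos <;> nlinarith
    · have h' : ((u : ℕ) : ℝ) + 1 ≤ (v : ℕ) := by exact_mod_cast h
      apply mul_pos_of_neg_of_neg <;> nlinarith

/-- The weights carried by the edges `{v, s v}`, `v ∈ M`. -/
noncomputable def matchingWeight {n : ℕ} (M : Finset (Fin n)) (s : Fin n → Fin n)
    (i j : Fin n) : ℝ :=
  if i ∈ M ∧ j = s i then (i : ℕ) + 1 else if j ∈ M ∧ i = s j then (j : ℕ) + 1 else 0

theorem matchingWeight_nonneg {n : ℕ} (M : Finset (Fin n)) (s : Fin n → Fin n) (i j : Fin n) :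
    0 ≤ matchingWeight M s i j := by
  unfold matchingWeight
  split_ifs <;> positivity

section Matching

variable {n : ℕ} {M : Finset (Fin n)} {s : Fin n → Fin n}

theorem matchingWeight_of_mem (hd : ∀ v ∈ M, s v ∉ M) {i : Fin n} (hi : i ∈ M) (j : Fin n) :
    matchingWeight M s i j = if j = s i then ((i : ℕ) + 1 : ℝ) else 0 := by
  have : ¬ (j ∈ M ∧ i = s j) := fun h => hd j h.1 (h.2 ▸ hi)
  simp [matchingWeight, hi, this]

theorem matchingWeight_succ (hs : Set.InjOn s M) (hd : ∀ v ∈ M, s v ∉ M) {i : Fin n}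
    (hi : i ∈ M) (j : Fin n) :
    matchingWeight M s (s i) j = if j = i then ((i : ℕ) + 1 : ℝ) else 0 := by
  by_cases h : j = i
  · subst h
    simp [matchingWeight, hi, hd j hi]
  · have : ¬ (j ∈ M ∧ s i = s j) := fun h' => h (hs h'.1 hi h'.2.symm)
    simp [matchingWeight, hd i hi, this, h]

theorem matchingWeight_of_notMem {i : Fin n} (hi : i ∉ M ∪ M.image s) (j : Fin n) :
    matchingWeight M s i j = 0 := by
  simp only [Finset.mem_union, Finset.mem_image, not_or, not_exists, not_and] at hi
  have : ¬ (j ∈ M ∧ i = s j) := fun h' => hi.2 j h'.1 h'.2.symm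
  simp [matchingWeight, hi.1, this]

theorem eval_charpoly_matching_sq {P : Matrix (Fin n) (Fin n) SignType}
    (hP : ∀ i j : Fin n, (i : ℕ) % 2 = j % 2 → P i j = 0)
    (hs : Set.InjOn s M) (hd : ∀ v ∈ M, s v ∉ M) (hpos : ∀ v ∈ M, P v (s v) * P (s v) v = 1)
    (x : ℝ) :
    (Matrix.of fun i j => (P i j : ℝ) * matchingWeight M s i j).charpoly.eval x ^ 2 =
      (x ^ ((M ∪ M.image s)ᶜ.card) * ∏ v ∈ M, (x ^ 2 - ((v : ℕ) + 1 : ℝ) ^ 2)) ^ 2 := by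
  set B : Matrix (Fin n) (Fin n) ℝ := Matrix.of fun i j => (P i j : ℝ) * matchingWeight M s i j
    with hB
  have hpos' : ∀ v ∈ M, (P v (s v) : ℝ) * (P (s v) v : ℝ) = 1 := by
    intro v hv
    have := hpos v hv
    generalize P v (s v) = p at *
    generalize P (s v) v = q at *
    revert this
    cases p <;> cases q <;> simp
  have h1 : ∀ v ∈ M, ∀ k, (B * B) v k = if v = k then ((v : ℕ) + 1 : ℝ) ^ 2 else 0 := by
    intro v hv k
    rw [mul_apply, Finset.sum_eq_single (s v)]
    · simp only [hB, of_apply, matchingWeight_of_mem hd hv, matchingWeight_succ hs hd hv]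
      by_cases h : k = v
      · subst h; simp; linear_combination ((k : ℕ) + 1 : ℝ) ^ 2 * hpos' k hv
      · simp [h, Ne.symm h]
    · intro j _ hj
      simp [hB, matchingWeight_of_mem hd hv, hj]
    · simp
  have h2 : ∀ v ∈ M, ∀ k, (B * B) (s v) k = if s v = k then ((v : ℕ) + 1 : ℝ) ^ 2 else 0 := by
    intro v hv k
    rw [mul_apply, Finset.sum_eq_single v]
    · simp only [hB, of_apply, matchingWeight_of_mem hd hv, matchingWeight_succ hs hd hv]
      by_cases h : k = s v
      · subst h; simp; linear_combination ((v : ℕ) + 1 : ℝ) ^ 2 * hpos' v hv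
      · simp [h, Ne.symm h]
    · intro j _ hj
      simp [hB, matchingWeight_succ hs hd hv, hj]
    · simp
  have h3 : ∀ i ∉ M ∪ M.image s, ∀ k, (B * B) i k = 0 := by
    intro i hi k
    rw [mul_apply]
    refine Finset.sum_eq_zero fun j _ => ?_
    simp [hB, matchingWeight_of_notMem hi]
  have hD : B * B = diagonal fun i => (B * B) i i := by
    ext i k
    by_cases hik : i = k
    · subst hik; simp
    · rw [diagonal_apply_ne _ hik]
      by_cases hi : i ∈ M ∪ M.image s
      · rcases Finset.mem_union.1 hi with hi | hi
        · rw [h1 i hi, if_neg hik]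
        · obtain ⟨v, hv, rfl⟩ := Finset.mem_image.1 hi
          rw [h2 v hv, if_neg hik]
      · exact h3 i hi k
  have hdisj : Disjoint M (M.image s) := by
    rw [Finset.disjoint_right]
    intro i hi
    obtain ⟨v, hv, rfl⟩ := Finset.mem_image.1 hi
    exact hd v hv
  have e1 : ∏ v ∈ M, (x ^ 2 - (B * B) v v) = ∏ v ∈ M, (x ^ 2 - ((v : ℕ) + 1 : ℝ) ^ 2) :=
    Finset.prod_congr rfl fun v hv => by rw [h1 v hv, if_pos rfl]
  have e2 : ∏ v ∈ M, (x ^ 2 - (B * B) (s v) (s v)) = ∏ v ∈ M, (x ^ 2 - ((v : ℕ) + 1 : ℝ) ^ 2) :=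
    Finset.prod_congr rfl fun v hv => by rw [h2 v hv, if_pos rfl]
  have e3 : ∏ v ∈ (M ∪ M.image s)ᶜ, (x ^ 2 - (B * B) v v) = ∏ v ∈ (M ∪ M.image s)ᶜ, x ^ 2 :=
    Finset.prod_congr rfl fun v hv => by rw [h3 v (Finset.mem_compl.1 hv), sub_zero]
  rw [eval_charpoly_sq_of_bipartite (fun i j h => by simp [hB, hP i j h]) hD,
    ← Finset.prod_mul_prod_compl (M ∪ M.image s), Finset.prod_union hdisj, Finset.prod_image hs,
    e1, e2, e3, Finset.prod_const]
  ring

/-- A matching of `r` positive edges can be made to dominate, which yields `r` positive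
eigenvalues. -/
theorem exists_qClass_isRoot_charpoly {P : Matrix (Fin n) (Fin n) SignType}
    (hP : ∀ i j : Fin n, (i : ℕ) % 2 = j % 2 → P i j = 0)
    (hs : Set.InjOn s M) (hd : ∀ v ∈ M, s v ∉ M) (hpos : ∀ v ∈ M, P v (s v) * P (s v) v = 1) :
    ∃ B, QClass P B ∧ ∃ R : Finset ℝ, R.card = M.card ∧ ∀ x ∈ R, 0 < x ∧ B.charpoly.IsRoot x := by
  set B : ℝ → Matrix (Fin n) (Fin n) ℝ := fun ε =>
    Matrix.of fun i j => (P i j : ℝ) * (matchingWeight M s i j + ε) with hB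
  have hcont : ∀ x : ℝ, Continuous fun ε => (B ε).charpoly.eval x := by
    intro x
    simp only [eval_charpoly]
    refine Continuous.matrix_det (continuous_const.sub ?_)
    refine continuous_matrix fun i j => ?_
    simp only [hB, of_apply]
    fun_prop
  have hev : ∀ᶠ ε in nhdsWithin (0 : ℝ) (Set.Ioi 0), ∀ u ∈ M,
      (B ε).charpoly.eval ((u : ℕ) + 1 / 2 : ℝ) * (B ε).charpoly.eval ((u : ℕ) + 3 / 2 : ℝ)
        < 0 := by
    rw [Filter.eventually_all_finset]
    intro u hu
    refine Filter.Eventually.filter_mono nhdsWithin_le_nhds ?_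
    refine ((hcont _).mul (hcont _)).continuousAt.eventually_lt continuousAt_const ?_
    have h0 : B 0 = Matrix.of fun i j => (P i j : ℝ) * matchingWeight M s i j := by
      simp [hB]
    change (B 0).charpoly.eval _ * (B 0).charpoly.eval _ < 0
    rw [h0]
    exact eval_mul_eval_neg_of_sq_eq (eval_charpoly_matching_sq hP hs hd hpos) hu
  obtain ⟨ε, hε, hε0⟩ := (hev.and self_mem_nhdsWithin).exists
  have hroot : ∀ u : Fin n, ∃ x : ℝ, u ∈ M →
      ((u : ℕ) + 1 / 2 : ℝ) < x ∧ x < (u : ℕ) + 3 / 2 ∧ (B ε).charpoly.IsRoot x := by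
    intro u
    by_cases hu : u ∈ M
    · have hle : ((u : ℕ) + 1 / 2 : ℝ) ≤ (u : ℕ) + 3 / 2 := by linarith
      have hc : ContinuousOn (fun x : ℝ => (B ε).charpoly.eval x)
        (Set.Icc ((u : ℕ) + 1 / 2 : ℝ) ((u : ℕ) + 3 / 2)) :=
        (B ε).charpoly.continuous.continuousOn
      rcases mul_neg_iff.1 (hε u hu) with ⟨h1, h2⟩ | ⟨h1, h2⟩
      · obtain ⟨x, hx, hx0⟩ := intermediate_value_Ioo' hle hc ⟨h2, h1⟩
        exact ⟨x, fun _ => ⟨hx.1, hx.2, hx0⟩⟩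
      · obtain ⟨x, hx, hx0⟩ := intermediate_value_Ioo hle hc ⟨h1, h2⟩
        exact ⟨x, fun _ => ⟨hx.1, hx.2, hx0⟩⟩
    · exact ⟨0, fun h => absurd h hu⟩
  choose r hr using hroot
  refine ⟨B ε, fun i j => ?_, M.image r, Finset.card_image_of_injOn ?_, ?_⟩
  · have : 0 < matchingWeight M s i j + ε :=
      add_pos_of_nonneg_of_pos (matchingWeight_nonneg M s i j) hε0
    simp only [hB, of_apply, sign_mul, sign_pos this, mul_one]
    cases P i j <;> simp
  · intro u hu v hv huv
    obtain ⟨h1, h2, -⟩ := hr u hu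
    obtain ⟨h3, h4, -⟩ := hr v hv
    have huv : r u = r v := huv
    have h5 : ((u : ℕ) : ℝ) < (v : ℕ) + 1 := by linarith
    have h6 : ((v : ℕ) : ℝ) < (u : ℕ) + 1 := by linarith
    norm_cast at h5 h6
    exact Fin.ext (by omega)
  · intro x hx
    obtain ⟨u, hu, rfl⟩ := Finset.mem_image.1 hx
    refine ⟨?_, (hr u hu).2.2⟩
    have : (0 : ℝ) ≤ (u : ℕ) := Nat.cast_nonneg _
    linarith [(hr u hu).1]

end Matching

theorem charRoots_eq {n : ℕ} (B : Matrix (Fin n) (Fin n) ℝ) :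
    charRoots B = (B.map (algebraMap ℝ ℂ)).charpoly.roots := by
  rw [charRoots, Matrix.charpoly_map]

theorem mem_charRoots {n : ℕ} {B : Matrix (Fin n) (Fin n) ℝ} {z : ℂ} :
    z ∈ charRoots B ↔ (scalar (Fin n) z - B.map (algebraMap ℝ ℂ)).det = 0 := by
  rw [charRoots_eq, mem_roots (Matrix.charpoly_monic _).ne_zero, IsRoot.def, Matrix.eval_charpoly]

theorem ofReal_mem_charRoots {n : ℕ} {B : Matrix (Fin n) (Fin n) ℝ} {x : ℝ}
    (hx : B.charpoly.IsRoot x) : (x : ℂ) ∈ charRoots B := by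
  rw [charRoots, mem_roots ((Matrix.charpoly_monic B).map _).ne_zero]
  exact hx.map

theorem inertia_sum {n : ℕ} (B : Matrix (Fin n) (Fin n) ℝ) :
    (inertia B).1 + (inertia B).2.1 + (inertia B).2.2 = n := by
  have hcard : (charRoots B).card = n := by
    rw [charRoots_eq, IsAlgClosed.card_roots_eq_natDegree, Matrix.charpoly_natDegree_eq_dim,
      Fintype.card_fin]
  have h : ∀ S : Multiset ℂ, (S.filter fun z => 0 < z.re).card + (S.filter fun z => z.re < 0).card
      + (S.filter fun z => z.re = 0).card = S.card := by
    intro S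
    induction S using Multiset.induction_on with
    | empty => simp
    | cons a S ih =>
      rcases lt_trichotomy a.re 0 with h | h | h
      · simp [h, h.not_gt, h.ne, ← ih]; ring
      · simp [h, ← ih]; ring
      · simp [h, h.not_gt, h.ne', ← ih]; ring
  exact (h _).trans hcard

theorem card_le_card_filter {S : Multiset ℂ} {p : ℂ → Prop} [DecidablePred p] {R : Finset ℂ}
    (hR : ∀ z ∈ R, z ∈ S ∧ p z) : R.card ≤ (S.filter p).card := by
  refine (Finset.card_le_card fun z hz => ?_).trans (Multiset.toFinset_card_le _)
  simpa using hR z hz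

theorem isRoot_charpoly_neg {n : ℕ} {B : Matrix (Fin n) (Fin n) ℝ}
    (hB : ∀ i j : Fin n, (i : ℕ) % 2 = j % 2 → B i j = 0) {x : ℝ} (hx : B.charpoly.IsRoot x) :
    B.charpoly.IsRoot (-x) := by
  have := Matrix.eval_charpoly_neg B x
  rw [Matrix.charpoly_neg_of_bipartite hB, hx.eq_zero] at this
  simpa using this.symm

theorem card_le_inertia_pos {n : ℕ} {B : Matrix (Fin n) (Fin n) ℝ} {R : Finset ℝ}
    (hR : ∀ x ∈ R, 0 < x ∧ B.charpoly.IsRoot x) : R.card ≤ (inertia B).1 := by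
  rw [← Finset.card_image_of_injective R Complex.ofReal_injective]
  refine card_le_card_filter fun z hz => ?_
  obtain ⟨x, hx, rfl⟩ := Finset.mem_image.1 hz
  exact ⟨ofReal_mem_charRoots (hR x hx).2, by simpa using (hR x hx).1⟩

theorem card_le_inertia_neg {n : ℕ} {B : Matrix (Fin n) (Fin n) ℝ}
    (hB : ∀ i j : Fin n, (i : ℕ) % 2 = j % 2 → B i j = 0) {R : Finset ℝ}
    (hR : ∀ x ∈ R, 0 < x ∧ B.charpoly.IsRoot x) : R.card ≤ (inertia B).2.1 := by
  rw [← Finset.card_image_of_injective R (Complex.ofReal_injective.comp neg_injective)]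
  refine card_le_card_filter fun z hz => ?_
  obtain ⟨x, hx, rfl⟩ := Finset.mem_image.1 hz
  exact ⟨ofReal_mem_charRoots (isRoot_charpoly_neg hB (hR x hx).2), by simpa using (hR x hx).1⟩

/-- Negating the odd rows of a bipartite matrix multiplies its eigenvalues by `I`. -/
theorem I_mul_mem_charRoots {n : ℕ} {B : Matrix (Fin n) (Fin n) ℝ}
    (hB : ∀ i j : Fin n, (i : ℕ) % 2 = j % 2 → B i j = 0) {x : ℝ} (hx : B.charpoly.IsRoot x) :
    (x * Complex.I : ℂ) ∈ charRoots (Matrix.of fun i j => (-1) ^ (i : ℕ) * B i j) := by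
  have h0 := mem_charRoots.1 (ofReal_mem_charRoots hx)
  rw [mem_charRoots]
  have h : scalar (Fin n) (x * Complex.I) -
      (Matrix.of fun i j : Fin n => (-1) ^ (i : ℕ) * B i j).map (algebraMap ℝ ℂ) =
      diagonal (fun i : Fin n => if (i : ℕ) % 2 = 0 then 1 else Complex.I) *
        (scalar (Fin n) (x : ℂ) - B.map (algebraMap ℝ ℂ)) *
        diagonal (fun i : Fin n => if (i : ℕ) % 2 = 0 then Complex.I else 1) := by
    ext i j
    rw [mul_diagonal, diagonal_mul]
    simp only [Matrix.sub_apply, scalar_apply, map_apply, of_apply]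
    by_cases hp : (i : ℕ) % 2 = j % 2
    · rw [hB i j hp]
      by_cases hij : i = j
      · subst hij
        rcases Nat.mod_two_eq_zero_or_one i with hi | hi <;> simp [hi, mul_comm]
      · simp [diagonal_apply_ne _ hij]
    · have hij : i ≠ j := fun h => hp (by rw [h])
      rw [diagonal_apply_ne _ hij, diagonal_apply_ne _ hij]
      rcases Nat.mod_two_eq_zero_or_one i with hi | hi <;>
        rcases Nat.mod_two_eq_zero_or_one j with hj | hj
      · omega
      · simp [hi, hj, (Nat.even_iff.2 hi).neg_one_pow]
      · simp [hi, hj, (Nat.odd_iff.2 hi).neg_one_pow]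
        linear_combination (B i j : ℂ) * Complex.I_mul_I
      · omega
  rw [h, det_mul, det_mul, h0, mul_zero, zero_mul]

theorem two_mul_card_le_inertia_zero {n : ℕ} {B : Matrix (Fin n) (Fin n) ℝ}
    (hB : ∀ i j : Fin n, (i : ℕ) % 2 = j % 2 → B i j = 0) {R : Finset ℝ}
    (hR : ∀ x ∈ R, 0 < x ∧ B.charpoly.IsRoot x) :
    2 * R.card ≤ (inertia (Matrix.of fun i j => (-1) ^ (i : ℕ) * B i j)).2.2 := by
  have hinj : Function.Injective fun x : ℝ => (x * Complex.I : ℂ) := fun x y h => by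
    simpa using h
  have hdisj : Disjoint R (R.image Neg.neg) := by
    rw [Finset.disjoint_left]
    intro x hx hx'
    obtain ⟨y, hy, rfl⟩ := Finset.mem_image.1 hx'
    linarith [(hR _ hx).1, (hR _ hy).1]
  have hcard : 2 * R.card =
      ((R ∪ R.image Neg.neg).image fun x : ℝ => (x * Complex.I : ℂ)).card := by
    rw [Finset.card_image_of_injective _ hinj, Finset.card_union_of_disjoint hdisj,
      Finset.card_image_of_injective _ neg_injective, two_mul]
  rw [hcard]
  refine card_le_card_filter fun z hz => ?_
  obtain ⟨x, hx, rfl⟩ := Finset.mem_image.1 hz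
  refine ⟨I_mul_mem_charRoots hB ?_, by simp⟩
  rcases Finset.mem_union.1 hx with hx | hx
  · exact (hR x hx).2
  · obtain ⟨y, hy, rfl⟩ := Finset.mem_image.1 hx
    exact isRoot_charpoly_neg hB (hR y hy).2

theorem QClass.eq_zero {n : ℕ} {P : Matrix (Fin n) (Fin n) SignType}
    {B : Matrix (Fin n) (Fin n) ℝ} (h : QClass P B) {i j : Fin n} (hP : P i j = 0) : B i j = 0 :=
  sign_eq_zero_iff.1 ((h i j).trans hP)

theorem exists_inertia_ne_of_matchings {n : ℕ} {P : Matrix (Fin n) (Fin n) SignType}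
    (hP : ∀ i j : Fin n, (i : ℕ) % 2 = j % 2 → P i j = 0) {s : Fin n → Fin n}
    (hs : Function.Injective s) {M N : Finset (Fin n)} (hM : ∀ v ∈ M, s v ∉ M)
    (hN : ∀ v ∈ N, s v ∉ N) (hMpos : ∀ v ∈ M, P v (s v) * P (s v) v = 1)
    (hNneg : ∀ v ∈ N, P v (s v) * P (s v) v = -1) (hcard : n < 2 * (M.card + N.card)) :
    ∃ B₁ B₂, QClass P B₁ ∧ QClass P B₂ ∧ inertia B₁ ≠ inertia B₂ := by
  obtain ⟨B₁, hB₁, R₁, hR₁, hroot₁⟩ := exists_qClass_isRoot_charpoly hP hs.injOn hM hMpos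
  have hP' : ∀ i j : Fin n, (i : ℕ) % 2 = j % 2 → (-1) ^ (i : ℕ) * P i j = 0 := by
    intro i j h
    rw [hP i j h, mul_zero]
  have hNpos : ∀ v ∈ N, (-1) ^ (v : ℕ) * P v (s v) * ((-1) ^ (s v : ℕ) * P (s v) v) = 1 := by
    intro v hv
    have hne : (v : ℕ) % 2 ≠ (s v : ℕ) % 2 := by
      intro h
      have := hNneg v hv
      rw [hP _ _ h, zero_mul] at this
      exact absurd this (by decide)
    have h1 : ((-1) ^ (v : ℕ) * (-1) ^ (s v : ℕ) : SignType) = -1 := by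
      rw [← pow_add]
      exact Odd.neg_one_pow (Nat.odd_iff.2 (by omega))
    rw [mul_mul_mul_comm, hNneg v hv, h1]
    decide
  obtain ⟨B₂, hB₂, R₂, hR₂, hroot₂⟩ :=
    exists_qClass_isRoot_charpoly (P := Matrix.of fun i j : Fin n => (-1) ^ (i : ℕ) * P i j)
      hP' hs.injOn hN hNpos
  refine ⟨B₁, Matrix.of fun i j => (-1) ^ (i : ℕ) * B₂ i j, hB₁, fun i j => ?_, fun h => ?_⟩
  · rw [of_apply, sign_mul, hB₂ i j, of_apply, ← mul_assoc]
    rcases Nat.even_or_odd (i : ℕ) with hi | hi <;> simp [hi.neg_one_pow]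
  · have h₁ := card_le_inertia_pos hroot₁
    have h₂ := card_le_inertia_neg (B := B₁) (fun i j hij => hB₁.eq_zero (hP i j hij)) hroot₁
    have h₃ := two_mul_card_le_inertia_zero (B := B₂) (fun i j hij => hB₂.eq_zero (hP' i j hij)) hroot₂
    rw [← h] at h₃
    have := inertia_sum B₁
    omega

theorem succ_mod_eq {n i : ℕ} (hi : i < n) :
    (i + 1) % n = i + 1 ∧ i + 1 < n ∨ (i + 1) % n = 0 ∧ i + 1 = n := by
  rcases Nat.lt_or_ge (i + 1) n with h | h
  · exact Or.inl ⟨Nat.mod_eq_of_lt h, h⟩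
  · obtain rfl : i + 1 = n := by omega
    exact Or.inr ⟨Nat.mod_self _, rfl⟩

/-- In an even cycle coloured by `e`, starting at `a` with a maximal monochromatic path of odd
length `k`, there is a set of more than `n / 2` edges whose adjacent members have different
colours. -/
theorem exists_alternating_edges {n : ℕ} (heven : Even n) {e : ℕ → SignType}
    (hper : ∀ i, e (i % n) = e i) {a k : ℕ} (hodd : Odd k) (hkn : k < n)
    (hpath : ∀ t, t ≤ k - 1 → e (a + t) = e a) (hpred : e (a + n - 1) ≠ e a)
    (hsucc : e (a + k) ≠ e a) :
    ∃ T : Finset (Fin n), n < 2 * T.card ∧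
      ∀ u ∈ T, ∀ v ∈ T, (v : ℕ) = (u + 1) % n → e v ≠ e u := by
  have hn : 0 < n := by omega
  obtain ⟨m, hm⟩ := heven
  obtain ⟨l, hl⟩ := hodd
  set φ : ℕ → ℕ := fun j => if j ≤ l then 2 * j else 2 * j - 1 with hφ
  have hφn : ∀ j ∈ Finset.range (m + 1), φ j < n := by
    intro j hj
    rw [Finset.mem_range] at hj
    simp only [hφ]
    split_ifs <;> omega
  have hmod : ∀ t t', t < n → t' < n → (a + t) % n = (a + t') % n → t = t' := by
    intro t t' ht ht' h
    have h' : t % n = t' % n := Nat.ModEq.add_left_cancel' a h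
    rwa [Nat.mod_eq_of_lt ht, Nat.mod_eq_of_lt ht'] at h'
  refine ⟨(Finset.range (m + 1)).image fun j => ⟨(a + φ j) % n, Nat.mod_lt _ hn⟩, ?_, ?_⟩
  · rw [Finset.card_image_of_injOn, Finset.card_range]
    · omega
    · intro i hi j hj h
      have := hmod _ _ (hφn i hi) (hφn j hj) (Fin.mk.inj_iff.1 h)
      simp only [hφ] at this
      split_ifs at this <;> omega
  · intro u hu v hv huv
    obtain ⟨i, hi, rfl⟩ := Finset.mem_image.1 hu
    obtain ⟨j, hj, rfl⟩ := Finset.mem_image.1 hv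
    have hin := hφn i hi
    have hjn := hφn j hj
    simp only [hper]
    have hsucc_eq : φ j = (φ i + 1) % n := by
      refine hmod _ _ hjn (Nat.mod_lt _ hn) ?_
      rw [Nat.add_mod_mod, ← add_assoc, ← Nat.mod_add_mod (a + φ i)]
      exact huv
    rcases succ_mod_eq hin with ⟨h, h'⟩ | ⟨h, h'⟩
    · have hij : φ i = k - 1 ∧ φ j = k := by
        rw [h] at hsucc_eq
        clear_value φ
        subst hφ
        dsimp only at *
        split_ifs at * <;> omega
      rw [hij.1, hij.2, hpath _ le_rfl]
      exact hsucc
    · rw [hsucc_eq, h, add_zero, show a + φ i = a + n - 1 by omega]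
      exact hpred.symm

/-- An `n`-cycle sign pattern with `0`-diagonal (`n ≥ 4` even, standard labeling) whose cycle
has a maximal signed path of odd length does not require a unique inertia.  Here `e i` is the
sign of the edge between `i` and `i + 1` (indices mod `n`); `e (a + n - 1)` is the edge sign
at index `a - 1 (mod n)`. -/
theorem even_cycle_odd_maximal_signed_path_not_unique_inertia (n : ℕ) (hn : 4 ≤ n)
    (heven : Even n)
    (P : Matrix (Fin n) (Fin n) SignType)
    (hcyc : ∀ i j : Fin n, P i j ≠ 0 ↔
      (((i : ℕ) + 1) % n = j ∨ ((j : ℕ) + 1) % n = i))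
    (e : ℕ → SignType)
    (he : ∀ i : ℕ, e i =
      P ⟨i % n, Nat.mod_lt _ (by omega)⟩ ⟨(i + 1) % n, Nat.mod_lt _ (by omega)⟩ *
        P ⟨(i + 1) % n, Nat.mod_lt _ (by omega)⟩ ⟨i % n, Nat.mod_lt _ (by omega)⟩)
    (hpath : ∃ a k : ℕ, a < n ∧ Odd k ∧ 1 ≤ k ∧ k < n ∧
      (∀ t, t ≤ k - 1 → e (a + t) = e a) ∧ e (a + n - 1) ≠ e a ∧ e (a + k) ≠ e a) :
    ∃ B₁ B₂, QClass P B₁ ∧ QClass P B₂ ∧ inertia B₁ ≠ inertia B₂ := by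
  have hP : ∀ i j : Fin n, (i : ℕ) % 2 = j % 2 → P i j = 0 := by
    intro i j hij
    by_contra h
    obtain ⟨m, hm⟩ := heven
    rcases (hcyc i j).1 h with h | h
    · rcases succ_mod_eq i.2 with h' | h' <;> omega
    · rcases succ_mod_eq j.2 with h' | h' <;> omega
  have hper : ∀ i, e (i % n) = e i := by
    intro i
    rw [he, he]
    simp only [Nat.mod_mod, Nat.mod_add_mod]
  obtain ⟨a, k, -, hodd, -, hkn, hpath, hpred, hsucc⟩ := hpath
  obtain ⟨T, hT, halt⟩ := exists_alternating_edges heven hper hodd hkn hpath hpred hsucc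
  set s : Fin n → Fin n := fun v => ⟨(v + 1) % n, Nat.mod_lt _ (by omega)⟩ with hs
  have hes : ∀ v : Fin n, e v = P v (s v) * P (s v) v := by
    intro v
    rw [he]
    simp only [Nat.mod_eq_of_lt v.2, hs]
  have hne : ∀ v : Fin n, e v ≠ 0 := by
    intro v
    rw [hes]
    exact mul_ne_zero ((hcyc _ _).2 (Or.inl rfl)) ((hcyc _ _).2 (Or.inr rfl))
  have hinj : Function.Injective s := by
    intro u v h
    have h' : ((u : ℕ) + 1) % n = (v + 1) % n := Fin.mk.inj_iff.1 h
    apply Fin.ext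
    rcases succ_mod_eq u.2 with hu | hu <;> rcases succ_mod_eq v.2 with hv | hv <;> omega
  have hmatch : ∀ c : SignType, ∀ v ∈ T.filter (fun v : Fin n => e v = c),
      s v ∉ T.filter (fun v : Fin n => e v = c) := by
    intro c v hv hv'
    rw [Finset.mem_filter] at hv hv'
    exact halt v hv.1 (s v) hv'.1 rfl (hv'.2.trans hv.2.symm)
  have hval : ∀ c : SignType, ∀ v ∈ T.filter (fun v : Fin n => e v = c), P v (s v) * P (s v) v = c :=
    fun c v hv => (hes v).symm.trans (Finset.mem_filter.1 hv).2
  refine exists_inertia_ne_of_matchings hP hinj (hmatch 1) (hmatch (-1)) (hval 1) (hval (-1)) ?_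
  have hfilter : T.filter (fun v : Fin n => ¬ e v = 1) = T.filter (fun v : Fin n => e v = -1) := by
    refine Finset.filter_congr fun v _ => ?_
    have := hne v
    revert this
    cases e v <;> decide
  rwa [← hfilter, Finset.card_filter_add_card_filter_not]
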